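/- Fix δ ∈ (0, 1/(16m)), set s := m^{1−δ}, assume c_1 := P(X_0^* ≥ 2) > 0, and let i, M be integers with n_2 ≤ i ≤ M − 2. Suppose s_i > 0 satisfies E( ((m−1)·X_i^{(M)} − 1)·s_i^{X_i^{(M)}} ) = 0 and that s_i ≥ m − m·δ^3. Then Δ_i^{(M)}(s) ≥ δ^2/128. -/

import Mathlib

noncomputable section

/-- One step of the Derrida–Retaux recursion on probability mass functions on ℕ. -/
def drStep (m : ℕ) (μ : ℕ → ℝ) : ℕ → ℝ :=
  fun j => ∑' x : Fin m → ℕ, if (∑ i, x i) - 1 = j then ∏ i, μ (x i) else 0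

/-- The mass function of `X_0`, namely `(1 - p)·δ_0 + p·ν`. -/
def mix (ν : ℕ → ℝ) (p : ℝ) : ℕ → ℝ :=
  fun k => (1 - p) * (if k = 0 then 1 else 0) + p * ν k

/-- The mass function of `X_n`. -/
def drLaw (m : ℕ) (ν : ℕ → ℝ) (p : ℝ) (n : ℕ) : ℕ → ℝ :=
  (drStep m)^[n] (mix ν p)

/-- The generating function `H_i^{(M)}(s) = E(s^{X_i ∧ (M - i)})` of the truncated
variable `X_i^{(M)}`, as a function of `s`. -/
def Hfn (m : ℕ) (ν : ℕ → ℝ) (p : ℝ) (i M : ℕ) : ℝ → ℝ :=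
  fun s => ∑' j : ℕ, drLaw m ν p i j * s ^ (min j (M - i))

/-- `Δ_i^{(M)}(s) = [H(s) - s(s-1)H'(s)] - ((m-1)(m-s)/m)[2sH'(s) + s²H''(s)]`. -/
def DeltaFn (m : ℕ) (H : ℝ → ℝ) (s : ℝ) : ℝ :=
  (H s - s * (s - 1) * deriv H s) -
    ((m : ℝ) - 1) * ((m : ℝ) - s) / m * (2 * s * deriv H s + s ^ 2 * deriv (deriv H) s)

lemma aux_pi (μ : ℕ → ℝ) (hnn : ∀ k, 0 ≤ μ k) (h : HasSum μ 1) (m : ℕ) :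
    HasSum (fun x : Fin m → ℕ => ∏ i, μ (x i)) 1 := by
  induction m with
  | zero =>
    have := hasSum_fintype (fun x : Fin 0 → ℕ => ∏ i, μ (x i))
    simpa using this
  | succ n ih =>
    have hs : Summable (fun x : ℕ × (Fin n → ℕ) => μ x.1 * ∏ i, μ (x.2 i)) :=
      Summable.mul_of_nonneg (f := μ) (g := fun x : Fin n → ℕ => ∏ i, μ (x i)) h.summable
        ih.summable (fun k => hnn k) (fun x => Finset.prod_nonneg fun i _ => hnn _)
    have h1 : HasSum (fun x : ℕ × (Fin n → ℕ) => μ x.1 * ∏ i, μ (x.2 i)) (1 * 1) :=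
      HasSum.mul (f := μ) (g := fun x : Fin n → ℕ => ∏ i, μ (x i)) h ih hs
    rw [← (Fin.consEquiv (fun _ : Fin (n+1) => ℕ)).hasSum_iff]
    simpa [Function.comp_def, Fin.prod_univ_succ, Fin.consEquiv] using h1

lemma step_nonneg (m : ℕ) (μ : ℕ → ℝ) (hnn : ∀ k, 0 ≤ μ k) (j : ℕ) : 0 ≤ drStep m μ j := by
  unfold drStep
  refine tsum_nonneg fun x => ?_
  split_ifs
  · exact Finset.prod_nonneg fun i _ => hnn _
  · exact le_rfl

lemma step_sum (m : ℕ) (μ : ℕ → ℝ) (hnn : ∀ k, 0 ≤ μ k) (h : HasSum μ 1) :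
    HasSum (drStep m μ) 1 := by
  have h1 := (aux_pi μ hnn h m).tsum_fiberwise (fun x : Fin m → ℕ => (∑ i, x i) - 1)
  have e : drStep m μ = fun c => ∑' b : ((fun x : Fin m → ℕ => (∑ i, x i) - 1) ⁻¹' {c}),
      ∏ i, μ (b.1 i) := by
    funext j
    rw [tsum_subtype ((fun x : Fin m → ℕ => (∑ i, x i) - 1) ⁻¹' {j})
      (fun x : Fin m → ℕ => ∏ i, μ (x i))]
    unfold drStep
    refine tsum_congr fun x => ?_
    simp [Set.indicator]
  rw [e]
  exact h1

lemma step_two (μ : ℕ → ℝ) :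
    drStep 2 μ 0 = μ 0 ^ 2 + 2 * μ 0 * μ 1 ∧ drStep 2 μ 1 = μ 1 ^ 2 + 2 * μ 0 * μ 2 := by
  have key : ∀ j, drStep 2 μ j = ∑' x : ℕ × ℕ, if x.1 + x.2 - 1 = j then μ x.1 * μ x.2 else 0 := by
    intro j
    unfold drStep
    rw [← (finTwoArrowEquiv ℕ).symm.tsum_eq]
    simp [finTwoArrowEquiv]
  constructor
  · rw [key, tsum_eq_sum (s := {(0,0),(0,1),(1,0)})]
    · rw [Finset.sum_insert (by decide), Finset.sum_insert (by decide), Finset.sum_singleton]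
      simp
      ring
    · rintro ⟨a, b⟩ hab
      simp only [Finset.mem_insert, Finset.mem_singleton, Prod.mk.injEq, not_or] at hab
      rw [if_neg]
      simp only
      omega
  · rw [key, tsum_eq_sum (s := {(0,2),(1,1),(2,0)})]
    · rw [Finset.sum_insert (by decide), Finset.sum_insert (by decide), Finset.sum_singleton]
      simp
      ring
    · rintro ⟨a, b⟩ hab
      simp only [Finset.mem_insert, Finset.mem_singleton, Prod.mk.injEq, not_or] at hab
      rw [if_neg]
      simp only
      omega

lemma law_succ (m : ℕ) (ν : ℕ → ℝ) (p : ℝ) (n : ℕ) :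
    drLaw m ν p (n+1) = drStep m (drLaw m ν p n) := by
  unfold drLaw
  rw [Function.iterate_succ_apply']

lemma law_prob (m : ℕ) (ν : ℕ → ℝ) (hνnn : ∀ k, 0 ≤ ν k) (h : HasSum ν 1)
    (p : ℝ) (hp : p ∈ Set.Ioo (0 : ℝ) 1) (n : ℕ) :
    (∀ k, 0 ≤ drLaw m ν p n k) ∧ HasSum (drLaw m ν p n) 1 := by
  induction n with
  | zero =>
    refine ⟨fun k => ?_, ?_⟩
    · simp only [drLaw, Function.iterate_zero, id, mix]
      have := mul_nonneg hp.1.le (hνnn k)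
      have := hp.2
      split_ifs <;> linarith
    · have h0 := (hasSum_ite_eq (0:ℕ) (1:ℝ)).mul_left (1 - p)
      have h2 := h0.add (h.mul_left p)
      have e : (1 - p) * 1 + p * 1 = 1 := by ring
      rw [e] at h2
      exact h2
  | succ n ih =>
    rw [law_succ]
    exact ⟨step_nonneg m _ ih.1, step_sum m _ ih.1 ih.2⟩

lemma three_le (μ : ℕ → ℝ) (hnn : ∀ k, 0 ≤ μ k) (h : HasSum μ 1) : μ 0 + μ 1 + μ 2 ≤ 1 := by
  have := sum_le_hasSum (Finset.range 3) (fun k _ => hnn k) h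
  simpa [Finset.sum_range_succ] using this

lemma a_pos (ν : ℕ → ℝ) (hν0 : ν 0 = 0) (hνnn : ∀ k, 0 ≤ ν k) (h : HasSum ν 1)
    (p : ℝ) (hp : p ∈ Set.Ioo (0 : ℝ) 1) (n : ℕ) : 0 < drLaw 2 ν p n 0 := by
  induction n with
  | zero =>
    simp only [drLaw, Function.iterate_zero, id, mix, hν0]
    have := hp.2
    simp; linarith
  | succ n ih =>
    rw [law_succ, (step_two _).1]
    have := (law_prob 2 ν hνnn h p hp n).1 1
    positivity

lemma good_step (a b d : ℝ) (a' b' : ℝ) (ha : 0 < a) (hb : 0 ≤ b) (hd : 0 ≤ d)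
    (hs : a + b + d ≤ 1) (ha' : a' = a ^ 2 + 2 * a * b) (hb' : b' = b ^ 2 + 2 * a * d)
    (hg : 1 / 4 ≤ a ∨ a ≤ 1 - a - b) : 1 / 4 ≤ a' ∨ a' ≤ 1 - a' - b' := by
  obtain ⟨c, hc⟩ : ∃ c, c = 1 - a - b := ⟨_, rfl⟩
  have hb2 : b = 1 - a - c := by linarith
  have hdc : d ≤ c := by linarith
  have hc' : c * (2 - 2 * a - c) ≤ 1 - a' - b' := by
    rw [ha', hb', hb2]; nlinarith
  have ha2 : a' = a * (2 - a - 2 * c) := by rw [ha', hb2]; ring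
  by_cases hca : a ≤ c
  · right
    refine le_trans ?_ hc'
    rw [ha2]
    have : 0 ≤ (c - a) * (2 - (a + c)) := mul_nonneg (by linarith) (by linarith)
    nlinarith
  · left
    push Not at hca
    have h4 : 1 / 4 ≤ a := by
      rcases hg with hg | hg
      · exact hg
      · linarith
    rw [ha2]
    by_cases h2 : 1 / 2 ≤ a
    · nlinarith
    · push Not at h2
      nlinarith

lemma c_step (a b d : ℝ) (a' b' : ℝ) (ha : 0 < a) (hb : 0 ≤ b) (hd : 0 ≤ d)
    (hs : a + b + d ≤ 1) (ha' : a' = a ^ 2 + 2 * a * b) (hb' : b' = b ^ 2 + 2 * a * d)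
    (hg : ¬ (1 / 4 ≤ a ∨ a ≤ 1 - a - b)) : 5 / 4 * (1 - a - b) ≤ 1 - a' - b' := by
  push Not at hg
  obtain ⟨h1, h2⟩ := hg
  obtain ⟨c, hc⟩ : ∃ c, c = 1 - a - b := ⟨_, rfl⟩
  have hb2 : b = 1 - a - c := by linarith
  have hdc : d ≤ c := by linarith
  have hc' : c * (2 - 2 * a - c) ≤ 1 - a' - b' := by
    rw [ha', hb', hb2]; nlinarith
  rw [← hc] at h2 ⊢
  nlinarith

lemma good_main (ν : ℕ → ℝ) (hν0 : ν 0 = 0) (hνnn : ∀ k, 0 ≤ ν k) (h : HasSum ν 1)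
    (p : ℝ) (hp : p ∈ Set.Ioo (0 : ℝ) 1) (c1 : ℝ) (hc1 : c1 = 1 - ν 1) (n : ℕ) :
    (1 / 4 ≤ drLaw 2 ν p n 0 ∨ drLaw 2 ν p n 0 ≤ 1 - drLaw 2 ν p n 0 - drLaw 2 ν p n 1) ∨
    (p > 3 / 4 ∧ (5 / 4) ^ n * (p * c1) ≤ 1 - drLaw 2 ν p n 0 - drLaw 2 ν p n 1) := by
  induction n with
  | zero =>
    by_cases hpp : p > 3 / 4
    · right
      refine ⟨hpp, ?_⟩
      simp [drLaw, mix, hν0, hc1]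
      linarith
    · left; left
      simp [drLaw, mix, hν0]
      linarith
  | succ n ih =>
    have hl := law_prob 2 ν hνnn h p hp n
    have ha := a_pos ν hν0 hνnn h p hp n
    have h3 := three_le _ hl.1 hl.2
    have e1 := (step_two (drLaw 2 ν p n)).1
    have e2 := (step_two (drLaw 2 ν p n)).2
    rw [← law_succ] at e1 e2
    by_cases hg : 1 / 4 ≤ drLaw 2 ν p n 0 ∨ drLaw 2 ν p n 0 ≤ 1 - drLaw 2 ν p n 0 - drLaw 2 ν p n 1
    · left
      exact good_step _ _ _ _ _ ha (hl.1 1) (hl.1 2) h3 e1 e2 hg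
    · right
      rcases ih with ih | ih
      · exact absurd ih hg
      · refine ⟨ih.1, ?_⟩
        have := c_step _ _ _ _ _ ha (hl.1 1) (hl.1 2) h3 e1 e2 hg
        rw [pow_succ]
        linarith [ih.2]

lemma good_final (ν : ℕ → ℝ) (hν0 : ν 0 = 0) (hνnn : ∀ k, 0 ≤ ν k) (h : HasSum ν 1)
    (p : ℝ) (hp : p ∈ Set.Ioo (0 : ℝ) 1) (c1 : ℝ) (hc1 : c1 = 1 - ν 1) (n : ℕ)
    (hn : 1 < (5 / 4) ^ n * c1) :
    1 / 4 ≤ drLaw 2 ν p n 0 ∨ drLaw 2 ν p n 0 ≤ 1 - drLaw 2 ν p n 0 - drLaw 2 ν p n 1 := by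
  rcases good_main ν hν0 hνnn h p hp c1 hc1 n with hg | ⟨h1, h2⟩
  · exact hg
  · by_contra hcon
    push Not at hcon
    have : p ≤ (5 / 4) ^ n * (p * c1) := by nlinarith [hp.1]
    linarith [hcon.1, hcon.2]

lemma trunc_sum (μ : ℕ → ℝ) (h : HasSum μ 1) (N : ℕ) (F : ℕ → ℝ) :
    ∑' j, μ j * F (min j N) =
      ∑ k ∈ Finset.range (N + 1), (if k < N then μ k else ∑' j, μ (j + N)) * F k := by
  have hs : Summable (fun j => μ j * F (min j N)) := by
    rw [← summable_nat_add_iff N]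
    have : Summable (fun j => μ (j + N) * F N) :=
      ((summable_nat_add_iff N).2 h.summable).mul_right _
    refine this.congr fun j => ?_
    simp
  rw [← hs.sum_add_tsum_nat_add N, Finset.sum_range_succ]
  congr 1
  · refine Finset.sum_congr rfl fun k hk => ?_
    have := Finset.mem_range.1 hk
    rw [if_pos this, min_eq_left this.le]
  · simp [tsum_mul_right]

lemma delta_poly (m : ℕ) (hm : 2 ≤ m) (q : ℕ → ℝ) (N : ℕ) (H : ℝ → ℝ)
    (hH : H = fun s => ∑ k ∈ Finset.range (N + 1), q k * s ^ k) (s : ℝ) :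
    DeltaFn m H s = - ∑ k ∈ Finset.range (N + 1),
      q k * (((m : ℝ) - 1) * k - 1) * (s ^ k * (1 + k * (1 - s / m))) := by
  have hm0 : (m : ℝ) ≠ 0 := by positivity
  have d1 : deriv H = fun s => ∑ k ∈ Finset.range (N + 1), q k * (k * s ^ (k - 1)) := by
    funext t
    rw [hH]
    refine HasDerivAt.deriv ?_
    exact HasDerivAt.fun_sum fun k _ => (hasDerivAt_pow k t).const_mul _
  have d2 : deriv (deriv H) = fun s => ∑ k ∈ Finset.range (N + 1),
      q k * (k * (((k - 1 : ℕ) : ℝ) * s ^ (k - 1 - 1))) := by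
    funext t
    rw [d1]
    refine HasDerivAt.deriv ?_
    exact HasDerivAt.fun_sum fun k _ => ((hasDerivAt_pow (k - 1) t).const_mul _).const_mul _
  unfold DeltaFn
  rw [d2, d1, hH]
  simp only [Finset.mul_sum, ← Finset.sum_sub_distrib, ← Finset.sum_add_distrib,
    ← Finset.sum_neg_distrib]
  refine Finset.sum_congr rfl fun k _ => ?_
  rcases k with _ | _ | k
  · simp
  · simp; field_simp; ring
  · simp only [Nat.add_sub_cancel]
    push_cast
    field_simp
    ring

lemma power_bound (κ r w : ℝ) (k : ℕ) (hk : 1 ≤ k) (hr : 0 ≤ r) (hw : 0 ≤ w) (hκ : 0 ≤ κ)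
    (h : r * (1 + w) ≤ 1 - κ) : r ^ k * (1 + k * w) ≤ 1 - κ := by
  have h1 : 1 + k * w ≤ (1 + w) ^ k := one_add_mul_le_pow (by linarith) k
  have h0 : 0 ≤ r * (1 + w) := by positivity
  calc r ^ k * (1 + k * w) ≤ r ^ k * (1 + w) ^ k := by gcongr
    _ = (r * (1 + w)) ^ k := by rw [mul_pow]
    _ ≤ (1 - κ) ^ k := by gcongr
    _ ≤ 1 - κ := pow_le_of_le_one (by linarith) (by linarith) (by omega)

lemma s_bounds (m : ℕ) (hm : 2 ≤ m) (δ : ℝ) (h0 : 0 < δ) (h1 : δ < 1 / 32) (s : ℝ)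
    (hs : s = (m : ℝ) ^ ((1 : ℝ) - δ)) : 0 < s ∧ δ / 2 ≤ 1 - s / m ∧ 0 < s / m := by
  have hm2 : (2 : ℝ) ≤ m := by exact_mod_cast hm
  have hm0 : (0 : ℝ) < m := by linarith
  have hspos : 0 < s := by rw [hs]; positivity
  refine ⟨hspos, ?_, by positivity⟩
  have e : s / m = ((m : ℝ) ^ δ)⁻¹ := by
    rw [hs, Real.rpow_sub hm0, Real.rpow_one]
    field_simp
  have h2 : 1 + 0.69 * δ ≤ (m : ℝ) ^ δ := by
    calc 1 + 0.69 * δ ≤ Real.log 2 * δ + 1 := by nlinarith [Real.log_two_gt_d9]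
      _ ≤ Real.exp (Real.log 2 * δ) := Real.add_one_le_exp _
      _ = (2 : ℝ) ^ δ := by rw [Real.rpow_def_of_pos (by norm_num)]
      _ ≤ (m : ℝ) ^ δ := Real.rpow_le_rpow (by norm_num) hm2 h0.le
  have h3 : ((m : ℝ) ^ δ)⁻¹ ≤ 1 - δ / 2 := by
    rw [inv_le_comm₀ (by linarith) (by linarith)]
    refine le_trans ?_ h2
    rw [inv_le_iff_one_le_mul₀ (by linarith)]
    nlinarith
  rw [e]; linarith

set_option maxHeartbeats 1000000 in
/-- Lemma 4.6, second inequality. Fix `δ ∈ (0, 1/(16m))` and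
`s = m^{1-δ}`. Let `n_2 ≤ i ≤ M - 2` and let `s_i > 0` satisfy
`E(((m-1)X_i^{(M)} - 1)s_i^{X_i^{(M)}}) = 0`. If `s_i ≥ m - mδ³`, then
`Δ_i^{(M)}(s) ≥ δ²/128`. -/
theorem Delta_lower_bound
    (m : ℕ) (hm : 2 ≤ m) (ν : ℕ → ℝ)
    (hν0 : ν 0 = 0) (hνnn : ∀ k, 0 ≤ ν k) (hνsum : ∑' k, ν k = 1)
    (δ : ℝ) (hδ : δ ∈ Set.Ioo (0 : ℝ) (1 / (16 * m)))
    (s : ℝ) (hs : s = (m : ℝ) ^ ((1 : ℝ) - δ))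
    (c1 : ℝ) (hc1 : c1 = ∑' j : ℕ, ν (j + 2)) (hc1pos : 0 < c1)
    (n2 : ℕ) (hn2 : (n2 : ℤ) = ⌊Real.log (1 / c1) / Real.log (5 / 4)⌋ + 1)
    (p : ℝ) (hp : p ∈ Set.Ioo (0 : ℝ) 1)
    (i M : ℕ) (hi : n2 ≤ i) (hiM : i + 2 ≤ M)
    (si : ℝ) (hsipos : 0 < si)
    (hsiroot : (∑' j : ℕ, (((m : ℝ) - 1) * ((min j (M - i) : ℕ) : ℝ) - 1) *
        si ^ (min j (M - i)) * drLaw m ν p i j) = 0)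
    (hsi : (m : ℝ) - m * δ ^ 3 ≤ si) :
    δ ^ 2 / 128 ≤ DeltaFn m (Hfn m ν p i M) s := by
  have hm2 : (2 : ℝ) ≤ m := by exact_mod_cast hm
  obtain ⟨hδ0, hδ1⟩ := hδ
  have hδ32 : δ < 1 / 32 := by
    refine hδ1.trans_le ?_
    apply one_div_le_one_div_of_le <;> linarith
  have hδ3 : δ ^ 3 ≤ δ ^ 2 / 32 := by nlinarith [sq_nonneg δ]
  have hδ2 : δ ^ 2 ≤ 1 / 1024 := by nlinarith
  have hν : HasSum ν 1 := by
    have : Summable ν := by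
      by_contra hc
      rw [tsum_eq_zero_of_not_summable hc] at hνsum
      norm_num at hνsum
    rw [← hνsum]; exact this.hasSum
  have hc1' : c1 = 1 - ν 1 := by
    have := hν.summable.sum_add_tsum_nat_add 2
    rw [hνsum, ← hc1] at this
    simp [Finset.sum_range_succ, hν0] at this
    linarith
  have hn : 1 < (5 / 4 : ℝ) ^ i * c1 := by
    have h1 : Real.log (1 / c1) / Real.log (5 / 4) < n2 := by
      have := Int.lt_floor_add_one (Real.log (1 / c1) / Real.log (5 / 4))
      have e : ((n2 : ℤ) : ℝ) = (⌊Real.log (1 / c1) / Real.log (5 / 4)⌋ : ℝ) + 1 := by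
        rw [hn2]; push_cast; ring
      rw [← e] at this
      exact_mod_cast this
    have h2 : (n2 : ℝ) ≤ i := by exact_mod_cast hi
    have hl : 0 < Real.log (5 / 4) := Real.log_pos (by norm_num)
    have h3 : Real.log (1 / c1) < i * Real.log (5 / 4) := by
      rw [← div_lt_iff₀ hl]; linarith
    rw [← Real.log_pow, Real.log_lt_log_iff (by positivity) (by positivity),
      div_lt_iff₀ hc1pos] at h3
    exact h3
  obtain ⟨hnn, hsum⟩ := law_prob m ν hνnn hν p hp i
  obtain ⟨N, hN⟩ : ∃ N, N = M - i := ⟨_, rfl⟩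
  have hN2 : 2 ≤ N := by omega
  rw [← hN] at hsiroot
  obtain ⟨q, hq⟩ : ∃ q : ℕ → ℝ, q = fun k => if k < N then drLaw m ν p i k
    else ∑' j, drLaw m ν p i (j + N) := ⟨_, rfl⟩
  have hT : ∀ F : ℕ → ℝ, ∑' j, drLaw m ν p i j * F (min j N) =
      ∑ k ∈ Finset.range (N + 1), q k * F k := by
    intro F
    rw [trunc_sum _ hsum N F, hq]
  have hq0 : ∀ k, 0 ≤ q k := by
    intro k
    rw [hq]
    dsimp only
    split_ifs
    · exact hnn k
    · exact tsum_nonneg fun j => hnn _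
  have hqz : q 0 = drLaw m ν p i 0 := by rw [hq]; simp only; rw [if_pos (by omega)]
  have hqo : q 1 = drLaw m ν p i 1 := by rw [hq]; simp only; rw [if_pos (by omega)]
  have hq1 : ∑ k ∈ Finset.range (N + 1), q k = 1 := by
    have := hT (fun _ => 1)
    simp only [mul_one] at this
    rw [← this, hsum.tsum_eq]
  have hroot : ∑ k ∈ Finset.range (N + 1), q k * ((((m : ℝ) - 1) * k - 1) * si ^ k) = 0 := by
    rw [← hT (fun k => (((m : ℝ) - 1) * k - 1) * si ^ k), ← hsiroot]
    refine tsum_congr fun j => ?_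
    ring
  have hH : Hfn m ν p i M = fun s => ∑ k ∈ Finset.range (N + 1), q k * s ^ k := by
    funext t
    rw [← hT (fun k => t ^ k), hN]
    rfl
  rw [delta_poly m hm q N _ hH]
  obtain ⟨K, rfl⟩ : ∃ K, N = K + 1 := ⟨N - 1, by omega⟩
  have hsi1 : 1 < si := by nlinarith
  -- lower bound for `q 0`
  have hquarter : 1 / 4 ≤ q 0 := by
    rcases hm.eq_or_lt with rfl | hm3
    · have hg := good_final ν hν0 hνnn hν p hp c1 hc1' i hn
      have ha := a_pos ν hν0 hνnn hν p hp i
      rw [← hqz, ← hqo] at hg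
      rw [← hqz] at ha
      rcases hg with hg | hg
      · exact hg
      · exfalso
        rw [Finset.sum_range_succ', Finset.sum_range_succ'] at hq1 hroot
        have hge : ∑ k ∈ Finset.range K, q (k + 1 + 1) * si ^ 2 ≤
            ∑ k ∈ Finset.range K, q (k + 1 + 1) *
              ((((2 : ℕ) : ℝ) - 1) * ((k + 1 + 1 : ℕ) : ℝ) - 1) * si ^ (k + 1 + 1) := by
          refine Finset.sum_le_sum fun k _ => ?_
          rw [mul_assoc]
          refine mul_le_mul_of_nonneg_left ?_ (hq0 _)
          have h1 : si ^ 2 ≤ si ^ (k + 1 + 1) := pow_le_pow_right₀ hsi1.le (by omega)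
          have h2 : (1 : ℝ) ≤ (((2 : ℕ) : ℝ) - 1) * ((k + 1 + 1 : ℕ) : ℝ) - 1 := by
            push_cast
            have : (0 : ℝ) ≤ k := by positivity
            linarith
          have h3 : 0 ≤ si ^ 2 := by positivity
          nlinarith
        rw [← Finset.sum_mul] at hge
        simp only [← mul_assoc] at hroot
        simp at hroot hge hq1
        have hs2 : 1 < si ^ 2 := by nlinarith
        nlinarith
    · have hm3' : (3 : ℝ) ≤ m := by exact_mod_cast hm3
      rw [Finset.sum_range_succ'] at hq1 hroot
      have hge : ∑ k ∈ Finset.range (K + 1), q (k + 1) ≤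
            ∑ k ∈ Finset.range (K + 1), q (k + 1) *
              ((((m : ℝ) - 1) * ((k + 1 : ℕ) : ℝ) - 1) * si ^ (k + 1)) := by
        refine Finset.sum_le_sum fun k _ => ?_
        refine le_mul_of_one_le_right (hq0 _) ?_
        have h1 : 1 ≤ si ^ (k + 1) := one_le_pow₀ hsi1.le
        have h2 : (1 : ℝ) ≤ ((m : ℝ) - 1) * ((k + 1 : ℕ) : ℝ) - 1 := by
          push_cast
          have : (0 : ℝ) ≤ k := by positivity
          nlinarith
        nlinarith
      simp at hroot hge
      linarith
  -- main estimate
  obtain ⟨hspos, hw, hu⟩ := s_bounds m hm δ hδ0 hδ32 s hs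
  have hr : s / si * (1 + (1 - s / m)) ≤ 1 - δ ^ 2 / 8 := by
    have hu' : s = m * (s / m) := by field_simp
    obtain ⟨u, hu2⟩ : ∃ u, u = s / m := ⟨_, rfl⟩
    rw [← hu2] at hu' hw hu ⊢
    have h1 : 0 < (1 - δ ^ 3) := by linarith
    rw [div_mul_eq_mul_div, div_le_iff₀ hsipos]
    have h2 : u * (1 + (1 - u)) ≤ (1 - δ ^ 2 / 8) * (1 - δ ^ 3) := by
      have a1 : (δ / 2) ^ 2 ≤ (1 - u) ^ 2 := by gcongr
      have a2 : 0 ≤ δ ^ 2 * δ ^ 3 := by positivity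
      have e1 : u * (1 + (1 - u)) = 1 - (1 - u) ^ 2 := by ring
      have e2 : (1 - δ ^ 2 / 8) * (1 - δ ^ 3) = 1 - δ ^ 2 / 8 - δ ^ 3 + δ ^ 2 * δ ^ 3 / 8 := by ring
      have e3 : (δ / 2) ^ 2 = δ ^ 2 / 4 := by ring
      have e4 : 0 ≤ δ ^ 2 := by positivity
      rw [e1, e2]
      linarith
    calc s * (1 + (1 - u)) = m * (u * (1 + (1 - u))) := by rw [hu']; ring
      _ ≤ m * ((1 - δ ^ 2 / 8) * (1 - δ ^ 3)) := by gcongr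
      _ = (1 - δ ^ 2 / 8) * (m - m * δ ^ 3) := by ring
      _ ≤ (1 - δ ^ 2 / 8) * si := by
        refine mul_le_mul_of_nonneg_left hsi ?_
        linarith
  have hmain : ∀ k ∈ Finset.range (K + 1),
      q (k + 1) * (((m : ℝ) - 1) * ((k + 1 : ℕ) : ℝ) - 1) *
        (s ^ (k + 1) * (1 + ((k + 1 : ℕ) : ℝ) * (1 - s / m))) ≤
      (1 - δ ^ 2 / 8) * (q (k + 1) * ((((m : ℝ) - 1) * ((k + 1 : ℕ) : ℝ) - 1) * si ^ (k + 1))) := by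
    intro k _
    have hA : (0 : ℝ) ≤ ((m : ℝ) - 1) * ((k + 1 : ℕ) : ℝ) - 1 := by
      push_cast
      have : (0 : ℝ) ≤ k := by positivity
      nlinarith
    have hb := power_bound (δ ^ 2 / 8) (s / si) (1 - s / m) (k + 1) (by omega) (by positivity)
      (by linarith) (by positivity) hr
    rw [div_pow, div_mul_eq_mul_div, div_le_iff₀ (by positivity)] at hb
    calc _ ≤ q (k + 1) * (((m : ℝ) - 1) * ((k + 1 : ℕ) : ℝ) - 1) *
          ((1 - δ ^ 2 / 8) * si ^ (k + 1)) :=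
          mul_le_mul_of_nonneg_left hb (mul_nonneg (hq0 _) hA)
      _ = _ := by ring
  have hS := Finset.sum_le_sum hmain
  rw [← Finset.mul_sum] at hS
  rw [Finset.sum_range_succ'] at hroot ⊢
  obtain ⟨S, hSS⟩ : ∃ S, S = ∑ k ∈ Finset.range (K + 1), q (k + 1) *
    ((((m : ℝ) - 1) * ((k + 1 : ℕ) : ℝ) - 1) * si ^ (k + 1)) := ⟨_, rfl⟩
  rw [← hSS] at hS hroot
  have hSq : S = q 0 := by
    simp at hroot
    linarith
  rw [hSq] at hS
  have hfin : δ ^ 2 / 8 * (1 / 4) ≤ δ ^ 2 / 8 * q 0 := by gcongr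
  simp only [Nat.cast_zero, mul_zero, zero_mul, pow_zero, add_zero, one_mul, zero_sub, mul_one]
  nlinarith [sq_nonneg δ]
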